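/- Let E be a linear regular tree expression, P_E its Bottom-Up Position automaton with tree extension Δ, and C(E) its compressed Bottom-Up Position automaton with tree extension Δ'. Then for every tree t over Σ, Δ(t) = Δ'(t); consequently P_E and C(E) recognize the same language. -/

import Mathlib

set_option autoImplicit false

/-- Trees over a ranked alphabet: a node is a symbol together with `rank f` children. -/
inductive RTree (σ : Type) (rank : σ → ℕ) : Type where
  | node : (f : σ) → (Fin (rank f) → RTree σ rank) → RTree σ rank

namespace RTree

variable {σ σ' : Type} {rank : σ → ℕ} {rank' : σ' → ℕ}

/-- Root symbol of a tree. -/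
def root : RTree σ rank → σ
  | node f _ => f

/-- `Sub s t`: `s` is a subtree of `t` (including `t` itself). -/
inductive Sub : RTree σ rank → RTree σ rank → Prop where
  | refl (t : RTree σ rank) : Sub t t
  | child {s : RTree σ rank} {f : σ} {ts : Fin (rank f) → RTree σ rank} (i : Fin (rank f)) :
      Sub s (ts i) → Sub s (node f ts)

/-- `father t f` : the set of pairs `(g, i)` such that some subtree of `t` has root `g`
whose `i`-th child has root `f` (indices are `0`-based). -/
def father (t : RTree σ rank) (f : σ) : Set (σ × ℕ) :=
  {p | ∃ ss : Fin (rank p.1) → RTree σ rank, Sub (node p.1 ss) t ∧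
        ∃ h : p.2 < rank p.1, root (ss ⟨p.2, h⟩) = f}

/-- Image of a tree under an alphabetical morphism (rank-preserving symbol map). -/
def map (φ : σ → σ') (hr : ∀ f, rank' (φ f) = rank f) : RTree σ rank → RTree σ' rank'
  | node f ts => node (φ f) (fun i => map φ hr (ts (Fin.cast (hr f) i)))

end RTree

/-- `Subst c L t t'` : `t'` is obtained from `t` by substituting every occurrence of the
(nullary) symbol `c` by some (possibly different) trees of `L`. -/
inductive Subst {σ : Type} {rank : σ → ℕ} (c : σ) (L : Set (RTree σ rank)) :
    RTree σ rank → RTree σ rank → Prop where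
  | base (ts : Fin (rank c) → RTree σ rank) {t' : RTree σ rank} :
      t' ∈ L → Subst c L (.node c ts) t'
  | node {f : σ} {ts ts' : Fin (rank f) → RTree σ rank} :
      f ≠ c → (∀ i, Subst c L (ts i) (ts' i)) → Subst c L (.node f ts) (.node f ts')

/-- `L' ·_c L`. -/
def substL {σ : Type} {rank : σ → ℕ} (L' : Set (RTree σ rank)) (c : σ)
    (L : Set (RTree σ rank)) : Set (RTree σ rank) :=
  {t' | ∃ t ∈ L', Subst c L t t'}

/-- `L^{c,n}`. -/
def substPow {σ : Type} {rank : σ → ℕ} (L : Set (RTree σ rank)) (c : σ) :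
    ℕ → Set (RTree σ rank)
  | 0 => {t | ∃ ts, t = RTree.node c ts}
  | n + 1 => substL L c (substPow L c n)

/-- `L^{*_c}`. -/
def substStar {σ : Type} {rank : σ → ℕ} (L : Set (RTree σ rank)) (c : σ) :
    Set (RTree σ rank) :=
  ⋃ n, substPow L c n

/-- Regular tree expressions. -/
inductive RExp (σ : Type) (rank : σ → ℕ) : Type where
  | symb (f : σ) (args : Fin (rank f) → RExp σ rank)
  | plus (E1 E2 : RExp σ rank)
  | prod (c : σ) (E1 E2 : RExp σ rank)
  | star (c : σ) (E : RExp σ rank)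

namespace RExp

variable {σ σ' : Type} {rank : σ → ℕ}

/-- Language denoted by a regular tree expression. -/
def lang : RExp σ rank → Set (RTree σ rank)
  | symb f args => {t | ∃ ts, (∀ i, ts i ∈ (args i).lang) ∧ t = RTree.node f ts}
  | plus E1 E2 => E1.lang ∪ E2.lang
  | prod c E1 E2 => substL E1.lang c E2.lang
  | star c E => substStar E.lang c

/-- Number of occurrences of a symbol in an expression. -/
def occ [DecidableEq σ] : RExp σ rank → σ → ℕ
  | symb f args, g => (if f = g then 1 else 0) + ∑ i, (args i).occ g
  | plus E1 E2, g => E1.occ g + E2.occ g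
  | prod _ E1 E2, g => E1.occ g + E2.occ g
  | star c E, g => (if c = g then 1 else 0) + E.occ g

/-- Well-formedness: products and stars use nullary symbols, and `E1 ·_c E2`
only appears when `c` occurs in `E1`. -/
def wf [DecidableEq σ] : RExp σ rank → Prop
  | symb _ args => ∀ i, (args i).wf
  | plus E1 E2 => E1.wf ∧ E2.wf
  | prod c E1 E2 => rank c = 0 ∧ 1 ≤ E1.occ c ∧ E1.wf ∧ E2.wf
  | star c E => rank c = 0 ∧ E.wf

/-- A linear expression: well-formed and every symbol of positive rank occurs at most once. -/
def Linear [DecidableEq σ] (E : RExp σ rank) : Prop :=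
  E.wf ∧ ∀ g : σ, 1 ≤ rank g → E.occ g ≤ 1

/-- Set of positions (symbols occurring in the expression). -/
def Pos [DecidableEq σ] (E : RExp σ rank) : Set σ :=
  {g | 1 ≤ E.occ g}

/-- `Root E` : roots of the trees of `L(E)`. -/
def Root (E : RExp σ rank) : Set σ :=
  {g | ∃ t ∈ E.lang, RTree.root t = g}

/-- `Father E f` : union of `father t f` over trees `t ∈ L(E)`. -/
def Father (E : RExp σ rank) (f : σ) : Set (σ × ℕ) :=
  ⋃ t ∈ E.lang, RTree.father t f

end RExp

/-- Rank function of the alphabet extended with a fresh unary symbol `$` (encoded `none`). -/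
def dollarRank {σ : Type} (rank : σ → ℕ) : Option σ → ℕ :=
  fun o => o.elim 1 rank

/-- Embedding of an expression into the `$`-extended alphabet. -/
def RExp.emb {σ : Type} {rank : σ → ℕ} : RExp σ rank → RExp (Option σ) (dollarRank rank)
  | .symb f args => .symb (some f) (fun i => (args i).emb)
  | .plus E1 E2 => .plus E1.emb E2.emb
  | .prod c E1 E2 => .prod (some c) E1.emb E2.emb
  | .star c E => .star (some c) E.emb

/-- `$(E)` : the expression `E` with the fresh unary symbol `$` on top. -/
def RExp.dollar {σ : Type} {rank : σ → ℕ} (E : RExp σ rank) :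
    RExp (Option σ) (dollarRank rank) :=
  .symb none (fun _ => E.emb)

/-- `Father($(E), f)` for a symbol `f` of the original alphabet. -/
def RExp.FatherD {σ : Type} {rank : σ → ℕ} (E : RExp σ rank) (f : σ) :
    Set (Option σ × ℕ) :=
  E.dollar.Father (some f)

/-- A (Bottom-Up) tree automaton with state type `Q`: final states and a transition relation. -/
structure TA (σ : Type) (rank : σ → ℕ) (Q : Type) where
  final : Set Q
  delta : (f : σ) → (Fin (rank f) → Q) → Set Q

namespace TA

variable {σ σ' : Type} {rank : σ → ℕ} {rank' : σ' → ℕ} {Q Q' : Type}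

/-- Extension of the transition function to trees. -/
def Delta (A : TA σ rank Q) : RTree σ rank → Set Q
  | .node f ts => {q | ∃ qs, (∀ i, qs i ∈ A.Delta (ts i)) ∧ q ∈ A.delta f qs}

/-- Language recognized by a tree automaton. -/
def lang (A : TA σ rank Q) : Set (RTree σ rank) :=
  {t | ∃ q ∈ A.Delta t, q ∈ A.final}

/-- Image of an automaton under an alphabetical morphism. -/
def image (φs : σ → σ') (hr : ∀ f, rank' (φs f) = rank f) (A : TA σ rank Q) :
    TA σ' rank' Q where
  final := A.final
  delta g qs := {q | ∃ f, ∃ h : φs f = g,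
    q ∈ A.delta f (fun i => qs (Fin.cast (congrArg rank' h) (Fin.cast (hr f).symm i)))}

/-- Quotient of an automaton by an equivalence on states. -/
def quot (A : TA σ rank Q) (s : Setoid Q) : TA σ rank (Quotient s) where
  final := {x | ∃ q, Quotient.mk s q = x ∧ q ∈ A.final}
  delta f xs := {x | ∃ (qs : Fin (rank f) → Q) (q : Q),
    (∀ i, Quotient.mk s (qs i) = xs i) ∧ q ∈ A.delta f qs ∧ Quotient.mk s q = x}

end TA

/-- The Bottom-Up Position automaton of an expression `E` (states are symbols). -/
def posTA {σ : Type} {rank : σ → ℕ} (E : RExp σ rank) : TA σ rank σ where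
  final := E.Root
  delta g qs := {q | q = g ∧ ∀ i : Fin (rank g), (g, (i : ℕ)) ∈ E.Father (qs i)}

/-- Extension of an equivalence relation to subsets of size at most one
(nonempty sets are related iff they contain related elements; `∅ ∼ ∅` only). -/
def SetEquiv {Q : Type} (r : Q → Q → Prop) (S S' : Set Q) : Prop :=
  (∀ q ∈ S, ∃ q' ∈ S', r q q') ∧ (∀ q' ∈ S', ∃ q ∈ S, r q q')

/-- A compressed tree automaton: transitions have sets of states as origins. -/
structure CTA (σ : Type) (rank : σ → ℕ) (Q : Type) where
  final : Set Q
  delta : (f : σ) → (Fin (rank f) → Set Q) → Set Q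

namespace CTA

variable {σ σ' : Type} {rank : σ → ℕ} {rank' : σ' → ℕ} {Q : Type}

/-- Restriction of compressed transitions to single states. -/
def deltaS (A : CTA σ rank Q) (f : σ) (qs : Fin (rank f) → Q) : Set Q :=
  {q | ∃ Qs : Fin (rank f) → Set Q, q ∈ A.delta f Qs ∧ ∀ i, qs i ∈ Qs i}

/-- Extension of compressed transitions to trees. -/
def Delta (A : CTA σ rank Q) : RTree σ rank → Set Q
  | .node f ts => {q | ∃ Qs : Fin (rank f) → Set Q,
      q ∈ A.delta f Qs ∧ ∀ i, (A.Delta (ts i) ∩ Qs i).Nonempty}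

/-- Language recognized by a compressed tree automaton. -/
def lang (A : CTA σ rank Q) : Set (RTree σ rank) :=
  {t | ∃ q ∈ A.Delta t, q ∈ A.final}

/-- Image of a compressed automaton under an alphabetical morphism. -/
def image (φs : σ → σ') (hr : ∀ f, rank' (φs f) = rank f) (A : CTA σ rank Q) :
    CTA σ' rank' Q where
  final := A.final
  delta g Qs := {q | ∃ f, ∃ h : φs f = g,
    q ∈ A.delta f (fun i => Qs (Fin.cast (congrArg rank' h) (Fin.cast (hr f).symm i)))}

/-- Quotient of a compressed automaton by an equivalence on states. -/
def quot (A : CTA σ rank Q) (s : Setoid Q) : CTA σ rank (Quotient s) where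
  final := {x | ∃ q, Quotient.mk s q = x ∧ q ∈ A.final}
  delta f Xs := {x | ∃ (qs : Fin (rank f) → Q) (q : Q),
    q ∈ A.deltaS f qs ∧ (∀ i, Quotient.mk s (qs i) ∈ Xs i) ∧ Quotient.mk s q = x}

end CTA

/-- The compressed Bottom-Up Position automaton of an expression `E`. -/
def cPosTA {σ : Type} {rank : σ → ℕ} (E : RExp σ rank) : CTA σ rank σ where
  final := E.Root
  delta f Qs := {q | q = f ∧ ∀ i : Fin (rank f), Qs i = {g | (f, (i : ℕ)) ∈ E.Father g}}

/-- The state type of the Father automaton: the sets `Father($(E), f)`. -/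
def FQ {σ : Type} {rank : σ → ℕ} (E : RExp σ rank) : Type :=
  {q : Set (Option σ × ℕ) // ∃ f : σ, q = E.FatherD f}

/-- The Father automaton of an expression `E`. -/
def fatherTA {σ : Type} {rank : σ → ℕ} (E : RExp σ rank) : TA σ rank (FQ E) where
  final := {q | ((none : Option σ), 0) ∈ q.1}
  delta g qs := {q | q.1 = E.FatherD g ∧ ∃ fs : Fin (rank g) → σ,
    (∀ i, (qs i).1 = E.FatherD (fs i)) ∧ ∀ i, (g, (i : ℕ)) ∈ E.Father (fs i)}

/-- The compressed Father automaton of an expression `E`. -/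
def cFatherTA {σ : Type} {rank : σ → ℕ} (E : RExp σ rank) : CTA σ rank (FQ E) where
  final := {q | ((none : Option σ), 0) ∈ q.1}
  delta f Qs := {q | q.1 = E.FatherD f ∧
    ∀ i : Fin (rank f), Qs i = {p : FQ E | ((some f : Option σ), (i : ℕ)) ∈ p.1}}

/-- The Father congruence: two symbols are equivalent when they have the same
fathers in `$(E)`. -/
def fatherSetoid {σ : Type} {rank : σ → ℕ} (E : RExp σ rank) : Setoid σ where
  r p p' := E.FatherD p = E.FatherD p'
  iseqv := { refl := fun _ => rfl, symm := Eq.symm, trans := Eq.trans }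

/-- The Bottom-Up Position automaton and its compressed version have
the same extension `Δ` to trees; consequently they recognize the same language. -/
theorem stmt13 {σ : Type} [DecidableEq σ] {rank : σ → ℕ}
    (E : RExp σ rank) (hE : E.Linear) :
    (∀ t : RTree σ rank, (posTA E).Delta t = (cPosTA E).Delta t) ∧
      (posTA E).lang = (cPosTA E).lang := by
  have key : ∀ t : RTree σ rank, (posTA E).Delta t = (cPosTA E).Delta t := by
    intro t
    induction t with
    | node f ts ih =>
      ext q
      simp only [TA.Delta, CTA.Delta, Set.mem_setOf_eq]
      constructor
      · rintro ⟨qs, h1, h2, h3⟩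
        refine ⟨fun i => {g | (f, (i : ℕ)) ∈ E.Father g}, ⟨h2, fun i => rfl⟩, fun i => ?_⟩
        exact ⟨qs i, ih i ▸ h1 i, h3 i⟩
      · rintro ⟨Qs, ⟨h1, h2⟩, h3⟩
        choose qs h4 h5 using h3
        refine ⟨qs, fun i => (ih i).symm ▸ h4 i, h1, fun i => ?_⟩
        have h6 := h5 i
        rw [h2 i] at h6
        exact h6
  refine ⟨key, ?_⟩
  ext t
  simp only [TA.lang, CTA.lang, Set.mem_setOf_eq, key]
  rfl
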